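/- arXiv:2408.07235 — 3 statements merged into one kernel-verified Lean document; each statement's English description precedes it below -/
import Mathlib

section
/- Let L ∈ B(H,G), let g : G → (−∞,+∞] be proper with a continuous affine minorant, let γ > 0, and set Φ = Q_G − Q_H ∘ L*. Then the proximal cocomposition satisfies L ⊚_γ g = (g* + γΦ)* ∘ L, i.e. for every x ∈ H, (L ⊚_γ g)(x) = sup_{y ∈ G} ( ⟪Lx, y⟫ − g*(y) − γΦ(y) ). -/
open scoped RealInnerProductSpace
open Filter Set

noncomputable section

/-- Fenchel (Legendre) conjugate of an extended-real-valued function. -/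
def fconj {H : Type*} [NormedAddCommGroup H] [InnerProductSpace ℝ H]
    (f : H → EReal) : H → EReal :=
  fun xs => ⨆ x : H, (⟪x, xs⟫ : EReal) - f x

/-- Moreau envelope of index `γ`. -/
def menv {H : Type*} [NormedAddCommGroup H] (γ : ℝ) (f : H → EReal) : H → EReal :=
  fun x => ⨅ y : H, f y + ((‖x - y‖ ^ 2 / (2 * γ) : ℝ) : EReal)

/-- Quadratic kernel `Q`. -/
def qk {H : Type*} [NormedAddCommGroup H] (x : H) : ℝ := ‖x‖ ^ 2 / 2

/-- Proximal composition `L ⊙_γ g`. -/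
def proxComp {H G : Type*} [NormedAddCommGroup H] [InnerProductSpace ℝ H]
    [NormedAddCommGroup G] [InnerProductSpace ℝ G]
    (L : H →L[ℝ] G) (γ : ℝ) (g : G → EReal) : H → EReal :=
  fun x => fconj (fun z => menv (1 / γ) (fconj g) (L z)) x - (((1 / γ) * qk x : ℝ) : EReal)

/-- Proximal cocomposition `L ⊚_γ g`. -/
def proxCocomp {H G : Type*} [NormedAddCommGroup H] [InnerProductSpace ℝ H]
    [NormedAddCommGroup G] [InnerProductSpace ℝ G]
    (L : H →L[ℝ] G) (γ : ℝ) (g : G → EReal) : H → EReal :=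
  fconj (proxComp L (1 / γ) (fconj g))

/-- `f` is proper: not identically `+∞` and never `−∞`. -/
def ProperE {H : Type*} (f : H → EReal) : Prop :=
  (∃ x, f x ≠ ⊤) ∧ ∀ x, f x ≠ ⊥

/-- `f` admits a continuous affine minorant. -/
def HasAffMinorant {H : Type*} [NormedAddCommGroup H] [InnerProductSpace ℝ H]
    (f : H → EReal) : Prop :=
  ∃ (u : H) (c : ℝ), ∀ x, ((⟪x, u⟫ + c : ℝ) : EReal) ≤ f x

/-- Convexity for extended-real-valued functions. -/
def ConvexE {H : Type*} [NormedAddCommGroup H] [InnerProductSpace ℝ H]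
    (f : H → EReal) : Prop :=
  ∀ x y : H, ∀ a b : ℝ, 0 < a → 0 < b → a + b = 1 →
    f (a • x + b • y) ≤ ((a : ℝ) : EReal) * f x + ((b : ℝ) : EReal) * f y

/-- The class `Γ₀`: proper, lower semicontinuous, convex. -/
def IsGamma0 {H : Type*} [NormedAddCommGroup H] [InnerProductSpace ℝ H]
    (f : H → EReal) : Prop :=
  ProperE f ∧ LowerSemicontinuous f ∧ ConvexE f

/-- `p` is a proximal point of `f` at `x`. -/
def IsProx {H : Type*} [NormedAddCommGroup H] (f : H → EReal) (x p : H) : Prop :=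
  ∀ y : H, f p + ((‖x - p‖ ^ 2 / 2 : ℝ) : EReal) ≤ f y + ((‖x - y‖ ^ 2 / 2 : ℝ) : EReal)

/-- Subdifferential. -/
def SubdiffE {H : Type*} [NormedAddCommGroup H] [InnerProductSpace ℝ H]
    (f : H → EReal) (x : H) : Set H :=
  {xs | ∀ y : H, (⟪y - x, xs⟫ : EReal) + f x ≤ f y}

/-- Recession function. -/
def recE {H : Type*} [NormedAddCommGroup H] (f : H → EReal) : H → EReal :=
  fun x => ⨆ y : {y : H // f y ≠ ⊤}, f (x + (y : H)) - f (y : H)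

end

theorem fconj_le_coe_iff {E : Type*} [NormedAddCommGroup E] [InnerProductSpace ℝ E]
    {f : E → EReal} {v : E} {t : ℝ} :
    fconj f v ≤ (t : EReal) ↔ ∀ x : E, ∀ r : ℝ, f x ≤ (r : EReal) → ⟪x, v⟫ - r ≤ t := by
  unfold fconj
  rw [iSup_le_iff]
  refine forall_congr' fun x => ?_
  induction f x with
  | bot =>
    simp only [bot_le, forall_const, EReal.coe_sub_bot, top_le_iff, EReal.coe_ne_top, false_iff,
      not_forall, not_le]
    exact ⟨⟪x, v⟫ - t - 1, by linarith⟩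
  | coe a =>
    norm_cast
    exact ⟨fun h r hr => by linarith, fun h => h a le_rfl⟩
  | top => simp

theorem isClosed_epigraph_fconj {E : Type*} [NormedAddCommGroup E] [InnerProductSpace ℝ E]
    (f : E → EReal) : IsClosed {p : E × ℝ | fconj f p.1 ≤ (p.2 : EReal)} := by
  simp only [fconj_le_coe_iff, Set.ofPred_forall]
  exact isClosed_iInter fun x => isClosed_iInter fun r => isClosed_iInter fun _ =>
    isClosed_le (by fun_prop) (by fun_prop)

theorem convex_epigraph_fconj {E : Type*} [NormedAddCommGroup E] [InnerProductSpace ℝ E]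
    (f : E → EReal) : Convex ℝ {p : E × ℝ | fconj f p.1 ≤ (p.2 : EReal)} := by
  intro p hp p' hp' a b ha hb hab
  simp only [Set.mem_ofPred_eq, fconj_le_coe_iff] at hp hp' ⊢
  intro x r hr
  have h := mul_le_mul_of_nonneg_left (hp x r hr) ha
  have h' := mul_le_mul_of_nonneg_left (hp' x r hr) hb
  obtain rfl : b = 1 - a := by linarith
  simp only [Prod.fst_add, Prod.smul_fst, Prod.snd_add, Prod.smul_snd, smul_eq_mul,
    inner_add_right, inner_smul_right]
  linarith

/-- Minimizing `t + q v` over a closed convex set of pairs `(v, t)`, for uniformly convex `q`. -/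
theorem exists_isMinOn_add_of_uniformConvex {E : Type*} [NormedAddCommGroup E] [NormedSpace ℝ E]
    [CompleteSpace E] {C : Set (E × ℝ)} (hne : C.Nonempty) (hcl : IsClosed C)
    (hcv : Convex ℝ C) {q : E → ℝ} (hq : Continuous q) {c : ℝ} (hc : 0 < c)
    (hqc : ∀ a b : E, q ((1 / 2 : ℝ) • a + (1 / 2 : ℝ) • b) ≤
      (q a + q b) / 2 - c * ‖a - b‖ ^ 2)
    {m₀ : ℝ} (hm₀ : ∀ p ∈ C, m₀ ≤ p.2 + q p.1) :
    ∃ p ∈ C, IsMinOn (fun p : E × ℝ => p.2 + q p.1) C p := by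
  set φ : E × ℝ → ℝ := fun p => p.2 + q p.1 with hφ
  have hbdd : BddBelow (φ '' C) := ⟨m₀, by rintro _ ⟨p, hp, rfl⟩; exact hm₀ p hp⟩
  set m := sInf (φ '' C) with hm
  have hmle : ∀ p ∈ C, m ≤ φ p := fun p hp => csInf_le hbdd ⟨p, hp, rfl⟩
  have hex : ∀ n : ℕ, ∃ p ∈ C, φ p < m + 1 / ((n : ℝ) + 1) := fun n => by
    obtain ⟨_, ⟨p, hp, rfl⟩, h⟩ := Real.lt_sInf_add_pos (hne.image φ)
      (Nat.one_div_pos_of_nat (α := ℝ) (n := n))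
    exact ⟨p, hp, h⟩
  choose p hpC hp using hex
  have hdist : ∀ i j : ℕ, c * ‖(p i).1 - (p j).1‖ ^ 2 ≤
      (1 / ((i : ℝ) + 1) + 1 / ((j : ℝ) + 1)) / 2 := fun i j => by
    have h1 := hmle _ (hcv (hpC i) (hpC j) (by norm_num : (0 : ℝ) ≤ 1 / 2)
      (by norm_num : (0 : ℝ) ≤ 1 / 2) (by norm_num))
    have h2 := hqc (p i).1 (p j).1
    have h3 := hp i
    have h4 := hp j
    simp only [hφ, Prod.fst_add, Prod.smul_fst, Prod.snd_add, Prod.smul_snd, smul_eq_mul]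
      at h1 h3 h4
    linarith
  have hcau : CauchySeq fun n => (p n).1 := by
    rw [Metric.cauchySeq_iff']
    intro ε hε
    obtain ⟨N, hN⟩ := exists_nat_one_div_lt (show 0 < c * ε ^ 2 by positivity)
    refine ⟨N, fun n hn => ?_⟩
    have h1 := hdist n N
    have h2 : 1 / ((n : ℝ) + 1) ≤ 1 / ((N : ℝ) + 1) := Nat.one_div_le_one_div hn
    rw [dist_eq_norm]
    refine lt_of_pow_lt_pow_left₀ 2 hε.le (lt_of_mul_lt_mul_left ?_ hc.le)
    linarith
  obtain ⟨v, hv⟩ := cauchySeq_tendsto_of_complete hcau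
  have hφlim : Tendsto (fun n => φ (p n)) atTop (nhds m) := by
    refine tendsto_of_tendsto_of_tendsto_of_le_of_le tendsto_const_nhds ?_
      (fun n => hmle _ (hpC n)) (fun n => (hp n).le)
    simpa using tendsto_const_nhds.add (tendsto_one_div_add_atTop_nhds_zero_nat (𝕜 := ℝ))
  have hqlim : Tendsto (fun n => q (p n).1) atTop (nhds (q v)) := (hq.tendsto v).comp hv
  have htlim : Tendsto (fun n => (p n).2) atTop (nhds (m - q v)) := by
    refine (hφlim.sub hqlim).congr fun n => ?_
    simp [hφ]
  refine ⟨(v, m - q v),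
    hcl.mem_of_tendsto (hv.prodMk_nhds htlim) (Eventually.of_forall hpC), fun p₁ hp₁ => ?_⟩
  simpa [hφ] using hmle p₁ hp₁

/-- First-order optimality for `t + q v` over a convex set, when `q` has a quadratic expansion at
the minimizer. -/
theorem inner_le_of_isMinOn_add {E : Type*} [NormedAddCommGroup E] [InnerProductSpace ℝ E]
    {C : Set (E × ℝ)} (hcv : Convex ℝ C) {q : E → ℝ} {p : E × ℝ} (hp : p ∈ C)
    (hmin : IsMinOn (fun p : E × ℝ => p.2 + q p.1) C p) {w : E} {K : E → ℝ}
    (hexp : ∀ (d : E) (τ : ℝ), q (p.1 + τ • d) = q p.1 - τ * ⟪w, d⟫ + τ ^ 2 * K d)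
    {p' : E × ℝ} (hp' : p' ∈ C) : p.2 + ⟪w, p'.1 - p.1⟫ ≤ p'.2 := by
  set d := p'.1 - p.1 with hd
  have key : ∀ τ ∈ Set.Ioc (0 : ℝ) 1, 0 ≤ p'.2 - p.2 - ⟪w, d⟫ + τ * K d := by
    rintro τ ⟨h0, h1⟩
    have h := hmin (hcv.add_smul_sub_mem hp hp' ⟨h0.le, h1⟩)
    simp only [Set.mem_ofPred_eq, Prod.fst_add, Prod.smul_fst, Prod.snd_add, Prod.smul_snd,
      smul_eq_mul, Prod.fst_sub, Prod.snd_sub, ← hd, hexp] at h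
    refine le_of_mul_le_mul_left (a := τ) ?_ h0
    linarith
  have hlim : Tendsto (fun τ : ℝ => p'.2 - p.2 - ⟪w, d⟫ + τ * K d) (nhdsWithin 0 (Set.Ioi 0))
      (nhds (p'.2 - p.2 - ⟪w, d⟫ + 0 * K d)) :=
    (Continuous.tendsto (by fun_prop) 0).mono_left nhdsWithin_le_nhds
  have := ge_of_tendsto hlim
    (eventually_of_mem (Ioc_mem_nhdsGT one_pos) key)
  linarith

section

variable {H G : Type*} [NormedAddCommGroup H] [InnerProductSpace ℝ H] [CompleteSpace H]
  [NormedAddCommGroup G] [InnerProductSpace ℝ G] [CompleteSpace G]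

theorem fconj_menv_comp_adjoint_le (L : H →L[ℝ] G) {g : G → EReal} {γ : ℝ} (hγ : 0 < γ)
    {y : G} {t : ℝ} (ht : fconj g y ≤ (t : EReal)) :
    fconj (fun z => menv γ (fconj (fconj g)) (L z)) (ContinuousLinearMap.adjoint L y) ≤
      ((t + γ * qk y : ℝ) : EReal) := by
  rw [fconj_le_coe_iff]
  intro z r hr
  suffices h : ((⟪L z, y⟫ - t - γ * qk y : ℝ) : EReal) ≤ menv γ (fconj (fconj g)) (L z) by
    have := EReal.coe_le_coe_iff.1 (h.trans hr)
    rw [ContinuousLinearMap.adjoint_inner_right]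
    linarith
  refine le_iInf fun w => ?_
  have h1 : ((⟪y, w⟫ - t : ℝ) : EReal) ≤ fconj (fconj g) w := by
    refine le_trans ?_ (le_iSup (fun v => (⟪v, w⟫ : EReal) - fconj g v) y)
    rw [EReal.coe_sub]
    exact EReal.sub_le_sub le_rfl ht
  refine le_trans ?_ (add_le_add_left h1 _)
  norm_cast
  have h2 : 0 ≤ ‖(L z - w) - γ • y‖ ^ 2 / (2 * γ) := by positivity
  have h3 : ‖(L z - w) - γ • y‖ ^ 2 / (2 * γ) =
      ‖L z - w‖ ^ 2 / (2 * γ) - ⟪L z, y⟫ + ⟪y, w⟫ + γ * qk y := by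
    rw [norm_sub_sq_real, inner_smul_right, inner_sub_left, norm_smul, Real.norm_of_nonneg hγ.le,
      real_inner_comm w y, qk]
    field_simp
    ring
  linarith

theorem exists_le_fconj_menv_comp (L : H →L[ℝ] G) {g : G → EReal} {γ : ℝ} (hγ : 0 < γ)
    {v₀ : G} {t₀ : ℝ} (hv₀ : fconj g v₀ ≤ (t₀ : EReal)) {m₀ : ℝ}
    (hm₀ : ∀ (v : G) (t : ℝ), fconj g v ≤ (t : EReal) → m₀ ≤ t + γ * qk v)
    (u : H) {n : ℝ} (hn : 0 ≤ n) :
    ∃ (v : G) (t : ℝ), fconj g v ≤ (t : EReal) ∧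
      ((t + γ * qk v + n * ‖u - ContinuousLinearMap.adjoint L v‖ ^ 2 : ℝ) : EReal) ≤
        fconj (fun z => menv γ (fconj (fconj g)) (L z)) u := by
  set A := ContinuousLinearMap.adjoint L with hA
  let q : G → ℝ := fun v => γ * qk v + n / 2 * ‖u - A v‖ ^ 2
  have hqdef : ∀ v, q v = γ * qk v + n / 2 * ‖u - A v‖ ^ 2 := fun _ => rfl
  have hq : Continuous q := by
    simp only [q, qk]
    fun_prop
  have hexp : ∀ (v d : G) (τ : ℝ), q (v + τ • d) =
      q v - τ * ⟪L (n • (u - A v)) - γ • v, d⟫ +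
        τ ^ 2 * (γ / 2 * ‖d‖ ^ 2 + n / 2 * ‖A d‖ ^ 2) := fun v d τ => by
    have h1 : u - A (v + τ • d) = (u - A v) - τ • A d := by
      rw [map_add, map_smul]; abel
    have h2 : ⟪L (n • (u - A v)), d⟫ = n * ⟪u - A v, A d⟫ := by
      rw [hA, ← ContinuousLinearMap.adjoint_inner_right, inner_smul_left]; simp
    rw [hqdef, hqdef, h1, norm_sub_sq_real, inner_sub_left (L (n • (u - A v))), h2, qk, qk, norm_add_sq_real, norm_smul, norm_smul,
      mul_pow, mul_pow, Real.norm_eq_abs, sq_abs, inner_smul_right,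
      inner_smul_right, inner_smul_left]
    simp only [conj_trivial]
    ring
  have hqc : ∀ a b : G, q ((1 / 2 : ℝ) • a + (1 / 2 : ℝ) • b) ≤
      (q a + q b) / 2 - γ / 8 * ‖a - b‖ ^ 2 := fun a b => by
    set c := (1 / 2 : ℝ) • a + (1 / 2 : ℝ) • b with hc
    have ha : a = c + (1 / 2 : ℝ) • (a - b) := by rw [hc]; module
    have hb : b = c + (-(1 / 2) : ℝ) • (a - b) := by rw [hc]; module
    have h1 := hexp c (a - b) (1 / 2)
    have h2 := hexp c (a - b) (-(1 / 2))
    rw [← ha] at h1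
    rw [← hb] at h2
    have h3 : 0 ≤ n * ‖A (a - b)‖ ^ 2 := by positivity
    linarith
  obtain ⟨⟨v, t⟩, hvt, hmin⟩ := exists_isMinOn_add_of_uniformConvex
    (C := {p : G × ℝ | fconj g p.1 ≤ (p.2 : EReal)}) ⟨(v₀, t₀), hv₀⟩
    (isClosed_epigraph_fconj g) (convex_epigraph_fconj g) hq (by positivity : 0 < γ / 8) hqc
    (m₀ := m₀) (fun p hp => by
      have h1 := hm₀ p.1 p.2 hp
      have h2 : 0 ≤ n / 2 * ‖u - A p.1‖ ^ 2 := by positivity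
      rw [hqdef]
      linarith)
  refine ⟨v, t, hvt, ?_⟩
  set z := n • (u - A v) with hz
  set w := L z - γ • v with hw
  have hbi : fconj (fconj g) w ≤ ((⟪w, v⟫ - t : ℝ) : EReal) := by
    rw [fconj_le_coe_iff]
    intro v' t' h'
    have h := inner_le_of_isMinOn_add (convex_epigraph_fconj g) hvt hmin (hexp v)
      (p' := (v', t')) h'
    simp only [← hz, ← hw, inner_sub_right] at h
    rw [real_inner_comm]
    linarith
  have henv : menv γ (fconj (fconj g)) (L z) ≤ ((⟪L z, v⟫ - t - γ * qk v : ℝ) : EReal) := by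
    refine (iInf_le _ w).trans ((add_le_add_left hbi _).trans ?_)
    norm_cast
    have h1 : L z - w = γ • v := by rw [hw]; abel
    rw [h1, hw, inner_sub_left, inner_smul_left, norm_smul, Real.norm_of_nonneg hγ.le, qk,
      real_inner_self_eq_norm_sq]
    simp only [conj_trivial]
    apply le_of_eq
    field_simp
    ring
  refine le_trans ?_ ((EReal.sub_le_sub le_rfl henv).trans
    (le_iSup (fun z => (⟪z, u⟫ : EReal) - menv γ (fconj (fconj g)) (L z)) z))
  norm_cast
  have h1 : ⟪L z, v⟫ = ⟪z, A v⟫ := by rw [hA, ContinuousLinearMap.adjoint_inner_right]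
  have h2 : ⟪z, u⟫ - ⟪z, A v⟫ = n * ‖u - A v‖ ^ 2 := by
    rw [← inner_sub_right, hz, inner_smul_left, real_inner_self_eq_norm_sq]; simp
  rw [h1]
  linarith

end

/-- `L ⊚_γ g = (g* + γΦ)* ∘ L`, where `Φ = Q_G − Q_H ∘ L*`; explicitly,
`(L ⊚_γ g)(x) = sup_y (⟪Lx, y⟫ − g*(y) − γΦ(y))`. -/
theorem proxCocomp_eq_conj_comp
    {H G : Type*} [NormedAddCommGroup H] [InnerProductSpace ℝ H] [CompleteSpace H]
    [NormedAddCommGroup G] [InnerProductSpace ℝ G] [CompleteSpace G]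
    (L : H →L[ℝ] G) (g : G → EReal) (hg : ProperE g) (hm : HasAffMinorant g)
    (γ : ℝ) (hγ : 0 < γ) :
    ∀ x : H, proxCocomp L γ g x =
      ⨆ y : G, (⟪L x, y⟫ : EReal) - fconj g y -
        ((γ * (qk y - qk (ContinuousLinearMap.adjoint L y)) : ℝ) : EReal) := by
  intro x
  obtain ⟨x₀, hx₀⟩ := hg.1
  lift g x₀ to ℝ using ⟨hx₀, hg.2 x₀⟩ with r₀ hr₀
  obtain ⟨v₀, c₀, hminor⟩ := hm
  have hv₀ : fconj g v₀ ≤ ((-c₀ : ℝ) : EReal) := by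
    rw [fconj_le_coe_iff]
    intro y r hr
    have := EReal.coe_le_coe_iff.1 ((hminor y).trans hr)
    linarith
  have hm₀ : ∀ (v : G) (t : ℝ), fconj g v ≤ (t : EReal) →
      -r₀ - ‖x₀‖ ^ 2 / (2 * γ) ≤ t + γ * qk v := fun v t h => by
    have h1 := fconj_le_coe_iff.1 h x₀ r₀ hr₀.ge
    have h2 : 0 ≤ ‖x₀ + γ • v‖ ^ 2 / (2 * γ) := by positivity
    have h3 : ‖x₀ + γ • v‖ ^ 2 / (2 * γ) = ‖x₀‖ ^ 2 / (2 * γ) + ⟪x₀, v⟫ + γ * qk v := by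
      rw [norm_add_sq_real, inner_smul_right, norm_smul, Real.norm_of_nonneg hγ.le, qk]
      field_simp
    linarith
  unfold proxCocomp proxComp
  simp only [one_div_one_div]
  set A := ContinuousLinearMap.adjoint L with hA
  apply le_antisymm
  · refine iSup_le fun u => ?_
    have happrox := fun (n : ℝ) (hn : 0 ≤ n) => exists_le_fconj_menv_comp L hγ hv₀ hm₀ u hn
    beta_reduce
    generalize fconj (fun z => menv γ (fconj (fconj g)) (L z)) u = s at happrox ⊢
    induction s with
    | bot =>
      obtain ⟨v, t, -, h⟩ := happrox 0 le_rfl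
      exact absurd (le_bot_iff.1 h) (EReal.coe_ne_bot _)
    | top =>
      rw [EReal.top_sub_coe, EReal.sub_top]
      exact bot_le
    | coe σ =>
      choose v t hvt hle using fun n : ℕ => happrox ((n : ℝ) + 1) (by positivity)
      simp only [EReal.coe_le_coe_iff, ← hA] at hle
      have hsq : ∀ n, ‖A (v n) - u‖ ^ 2 ≤
          (σ - (-r₀ - ‖x₀‖ ^ 2 / (2 * γ))) * (1 / ((n : ℝ) + 1)) := fun n => by
        have h1 := hle n
        have h2 := hm₀ _ _ (hvt n)
        rw [mul_one_div, le_div_iff₀ (by positivity), norm_sub_rev]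
        linarith
      have hlim : Tendsto (fun n => A (v n)) atTop (nhds u) := by
        rw [tendsto_iff_norm_sub_tendsto_zero]
        have h0 : Tendsto (fun n => ‖A (v n) - u‖ ^ 2) atTop (nhds 0) :=
          squeeze_zero (fun n => by positivity) hsq (by
            simpa using (tendsto_one_div_add_atTop_nhds_zero_nat (𝕜 := ℝ)).const_mul _)
        simpa [Real.sqrt_sq] using h0.sqrt
      have hcont : Continuous fun a : H => ((⟪a, x⟫ - (σ - γ * qk a) : ℝ) : EReal) :=
        continuous_coe_real_ereal.comp (by unfold qk; fun_prop)
      have := (hcont.tendsto u).comp hlim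
      rw [← EReal.coe_sub, ← EReal.coe_sub]
      refine le_of_tendsto' this fun n => le_trans ?_ (le_iSup _ (v n))
      refine le_trans ?_ (EReal.sub_le_sub (EReal.sub_le_sub le_rfl (hvt n)) le_rfl)
      simp only [Function.comp_apply]
      norm_cast
      have h1 := hle n
      have h2 : 0 ≤ ((n : ℝ) + 1) * ‖u - A (v n)‖ ^ 2 := by positivity
      have h3 : ⟪A (v n), x⟫ = ⟪L x, v n⟫ := by
        rw [hA, ContinuousLinearMap.adjoint_inner_left, real_inner_comm]
      rw [h3]
      linarith
  · refine iSup_le fun y => ?_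
    have hbot : fconj g y ≠ ⊥ := fun h => by
      have h1 := fconj_le_coe_iff.1
        (h.trans_le bot_le : fconj g y ≤ ((⟪x₀, y⟫ - r₀ - 1 : ℝ) : EReal)) x₀ r₀ hr₀.ge
      linarith
    by_cases htop : fconj g y = ⊤
    · simp [htop]
    obtain ⟨t, ht⟩ : ∃ t : ℝ, fconj g y = t := ⟨_, (EReal.coe_toReal htop hbot).symm⟩
    refine le_trans ?_ (le_iSup _ (A y))
    refine le_trans ?_ (EReal.sub_le_sub le_rfl (EReal.sub_le_sub
      (fconj_menv_comp_adjoint_le L hγ ht.le) le_rfl))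
    rw [ht]
    norm_cast
    have h3 : ⟪A y, x⟫ = ⟪L x, y⟫ := by
      rw [hA, ContinuousLinearMap.adjoint_inner_left, real_inner_comm]
    rw [h3]
    linarith
end

section
/- Let L ∈ B(H,G) with L ≠ 0, let g : G → (−∞,+∞] be proper with a continuous affine minorant, let γ > 0, and let α ≥ −1/γ be such that g** − α·Q_G is convex. Set β = (α + 1/γ)/‖L‖² − 1/γ. Then L ⊙_γ g − β·Q_H is a proper lower semicontinuous convex function from H to (−∞,+∞]. -/
open scoped RealInnerProductSpace
open Filter Set

section Helpers

variable {H G : Type*} [NormedAddCommGroup H] [InnerProductSpace ℝ H]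
  [NormedAddCommGroup G] [InnerProductSpace ℝ G]

lemma norm_sq_convex_combination (x y : H) {a b : ℝ} (hab : a + b = 1) :
    ‖a • x + b • y‖ ^ 2 = a * ‖x‖ ^ 2 + b * ‖y‖ ^ 2 - a * b * ‖x - y‖ ^ 2 := by
  obtain rfl : b = 1 - a := by linarith
  rw [norm_add_sq_real, norm_sub_sq_real, norm_smul, norm_smul, inner_smul_left,
    inner_smul_right, mul_pow, mul_pow, Real.norm_eq_abs, Real.norm_eq_abs, sq_abs, sq_abs]
  simp only [conj_trivial]
  ring

lemma inner_le_scaled_norm_sq {γ : ℝ} (hγ : 0 < γ) (w y : G) :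
    ⟪w, y⟫ ≤ γ / 2 * ‖w‖ ^ 2 + ‖y‖ ^ 2 / (2 * γ) := by
  have h : 0 ≤ ‖γ • w - y‖ ^ 2 / (2 * γ) := by positivity
  rw [norm_sub_sq_real, norm_smul, inner_smul_left, mul_pow, Real.norm_eq_abs, sq_abs] at h
  simp only [conj_trivial] at h
  have e : (γ ^ 2 * ‖w‖ ^ 2 - 2 * (γ * ⟪w, y⟫) + ‖y‖ ^ 2) / (2 * γ)
      = γ / 2 * ‖w‖ ^ 2 + ‖y‖ ^ 2 / (2 * γ) - ⟪w, y⟫ := by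
    field_simp
    ring
  linarith

lemma fconj_le_coe_iff_s7 (f : H → EReal) (v : H) (s : ℝ) :
    fconj f v ≤ (s : EReal) ↔ ∀ y, ((⟪y, v⟫ - s : ℝ) : EReal) ≤ f y := by
  unfold fconj
  rw [iSup_le_iff]
  refine forall_congr' fun y => ?_
  induction f y using EReal.rec with
  | bot => rw [EReal.coe_sub_bot, top_le_iff, le_bot_iff]; exact
      ⟨fun h => absurd h (EReal.coe_ne_top s), fun h => absurd h (EReal.coe_ne_bot _)⟩
  | top => simp
  | coe t => norm_cast; constructor <;> intro h <;> linarith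

lemma fconj_convex_combination_le (f : H → EReal) {v w : H} {s t a b : ℝ}
    (ha : 0 ≤ a) (hb : 0 ≤ b) (hab : a + b = 1)
    (hv : fconj f v ≤ (s : EReal)) (hw : fconj f w ≤ (t : EReal)) :
    fconj f (a • v + b • w) ≤ ((a * s + b * t : ℝ) : EReal) := by
  rw [fconj_le_coe_iff_s7] at *
  intro y
  have e : ⟪y, a • v + b • w⟫ - (a * s + b * t)
      = a * (⟪y, v⟫ - s) + b * (⟪y, w⟫ - t) := by
    rw [inner_add_right, inner_smul_right, inner_smul_right]; ring
  rw [e]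
  obtain rfl : b = 1 - a := by linarith
  rcases le_total (⟪y, v⟫ - s) (⟪y, w⟫ - t) with h | h
  · refine le_trans (EReal.coe_le_coe_iff.2 ?_) (hw y)
    nlinarith
  · refine le_trans (EReal.coe_le_coe_iff.2 ?_) (hv y)
    nlinarith

lemma fconj_fconj_le_coe (f : H → EReal) {y : H} {r : ℝ} (h : f y ≤ (r : EReal)) :
    fconj (fconj f) y ≤ (r : EReal) := by
  rw [fconj_le_coe_iff_s7]
  intro v
  refine le_trans ?_ (le_iSup (fun x => (⟪x, v⟫ : EReal) - f x) y)
  rw [real_inner_comm, EReal.coe_sub]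
  exact EReal.sub_le_sub le_rfl h

lemma menv_le_coe {E : Type*} [NormedAddCommGroup E] (F : E → EReal) (γ : ℝ) {v : E} {s : ℝ}
    (h : F v ≤ (s : EReal)) (z : E) :
    menv (1 / γ) F z ≤ ((s + γ / 2 * ‖z - v‖ ^ 2 : ℝ) : EReal) := by
  refine (iInf_le _ v).trans ?_
  have e : ‖z - v‖ ^ 2 / (2 * (1 / γ)) = γ / 2 * ‖z - v‖ ^ 2 := by
    rw [mul_one_div, div_div_eq_mul_div]; ring
  rw [e, EReal.coe_add]
  gcongr

lemma exists_of_menv_lt_coe {E : Type*} [NormedAddCommGroup E] (F : E → EReal) (γ : ℝ)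
    {z : E} {t : ℝ}
    (h : menv (1 / γ) F z < (t : EReal)) :
    ∃ (v : E) (s : ℝ), F v ≤ (s : EReal) ∧ s + γ / 2 * ‖z - v‖ ^ 2 < t := by
  obtain ⟨v, hv⟩ := iInf_lt_iff.1 h
  have e : ‖z - v‖ ^ 2 / (2 * (1 / γ)) = γ / 2 * ‖z - v‖ ^ 2 := by
    rw [mul_one_div, div_div_eq_mul_div]; ring
  rw [e] at hv
  generalize hq : γ / 2 * ‖z - v‖ ^ 2 = q at hv
  have hv' : F v < ((t - q : ℝ) : EReal) := by
    rw [EReal.coe_sub]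
    exact EReal.lt_sub_iff_add_lt (by simp) (by simp) |>.2 hv
  obtain ⟨s, hs, hst⟩ := EReal.lt_iff_exists_real_btwn.1 hv'
  exact ⟨v, s, hs.le, by have := EReal.coe_lt_coe_iff.1 hst; linarith⟩

lemma coe_le_menv_fconj (g : G → EReal) {γ : ℝ} (hγ : 0 < γ) {y : G} {r : ℝ}
    (h : fconj (fconj g) y ≤ (r : EReal)) (z : G) :
    ((⟪z, y⟫ - r - ‖y‖ ^ 2 / (2 * γ) : ℝ) : EReal) ≤ menv (1 / γ) (fconj g) z := by
  by_contra! hlt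
  obtain ⟨v, s, hs, hst⟩ := exists_of_menv_lt_coe _ _ hlt
  have h1 := EReal.coe_le_coe_iff.1 (((fconj_le_coe_iff_s7 _ _ _).1 h v).trans hs)
  have h2 := inner_le_scaled_norm_sq hγ (z - v) y
  rw [inner_sub_left] at h2
  linarith

/-- The Moreau envelope of the conjugate of a proper function minorized by an affine function is
real-valued. -/
lemma exists_real_menv_fconj {g : G → EReal} (hg : ProperE g) (hm : HasAffMinorant g)
    {γ : ℝ} (hγ : 0 < γ) :
    ∃ h : G → ℝ, ∀ z, menv (1 / γ) (fconj g) z = (h z : EReal) := by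
  obtain ⟨u, c, huc⟩ := hm
  obtain ⟨⟨y, hy⟩, -⟩ := hg
  have hu : fconj g u ≤ ((-c : ℝ) : EReal) := by
    rw [fconj_le_coe_iff_s7]; intro x; simpa using huc x
  refine ⟨fun z => (menv (1 / γ) (fconj g) z).toReal, fun z => (EReal.coe_toReal ?_ ?_).symm⟩
  · exact ((menv_le_coe _ γ hu z).trans_lt (EReal.coe_lt_top _)).ne
  · exact ((EReal.bot_lt_coe _).trans_le
      (coe_le_menv_fconj g hγ (fconj_fconj_le_coe g (EReal.le_coe_toReal hy)) z)).ne'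

lemma convexOn_menv_fconj {g : G → EReal} {γ : ℝ} (hγ : 0 < γ) {h : G → ℝ}
    (hh : ∀ z, menv (1 / γ) (fconj g) z = (h z : EReal)) : ConvexOn ℝ univ h := by
  refine ⟨convex_univ, fun z _ w _ a b ha hb hab => le_of_forall_pos_le_add fun ε hε => ?_⟩
  obtain ⟨v₁, s₁, h₁, l₁⟩ := exists_of_menv_lt_coe (fconj g) γ (z := z) (t := h z + ε)
    (by rw [hh]; exact_mod_cast lt_add_of_pos_right _ hε)
  obtain ⟨v₂, s₂, h₂, l₂⟩ := exists_of_menv_lt_coe (fconj g) γ (z := w) (t := h w + ε)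
    (by rw [hh]; exact_mod_cast lt_add_of_pos_right _ hε)
  have key := menv_le_coe _ γ (fconj_convex_combination_le g ha hb hab h₁ h₂) (a • z + b • w)
  rw [hh, EReal.coe_le_coe_iff] at key
  have e : a • z + b • w - (a • v₁ + b • v₂) = a • (z - v₁) + b • (w - v₂) := by
    simp only [smul_sub]; abel
  rw [e, norm_sq_convex_combination _ _ hab] at key
  have hq : 0 ≤ γ / 2 * (a * b * ‖z - v₁ - (w - v₂)‖ ^ 2) := by positivity
  simp only [smul_eq_mul]
  have m₁ := mul_le_mul_of_nonneg_left l₁.le ha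
  have m₂ := mul_le_mul_of_nonneg_left l₂.le hb
  have m₃ : a * ε + b * ε = ε := by rw [← add_mul, hab, one_mul]
  linarith

lemma continuous_menv_fconj {g : G → EReal} (hm : HasAffMinorant g) {γ : ℝ} (hγ : 0 < γ)
    {h : G → ℝ} (hh : ∀ z, menv (1 / γ) (fconj g) z = (h z : EReal)) : Continuous h := by
  obtain ⟨u, c, huc⟩ := hm
  have hu : fconj g u ≤ ((-c : ℝ) : EReal) := by
    rw [fconj_le_coe_iff_s7]; intro x; simpa using huc x
  have hle : ∀ z, h z ≤ -c + γ / 2 * ‖z - u‖ ^ 2 := fun z => by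
    have := menv_le_coe _ γ hu z
    rwa [hh, EReal.coe_le_coe_iff] at this
  rw [← continuousOn_univ]
  have htfae := ((convexOn_menv_fconj hγ hh).continuousOn_tfae isOpen_univ univ_nonempty).out 1 3
  refine htfae.2 ⟨u, mem_univ u, ?_⟩
  have hc : ContinuousAt (fun z : G => -c + γ / 2 * ‖z - u‖ ^ 2) u := by fun_prop
  exact Filter.IsBoundedUnder.mono_le hc.isBoundedUnder_le (Eventually.of_forall hle)

/-- Approximate duality: the Moreau envelope of `g*` is the conjugate of `g** + Q / γ`. -/
lemma exists_menv_fconj_le [CompleteSpace G] {g : G → EReal} (hm : HasAffMinorant g)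
    {γ : ℝ} (hγ : 0 < γ)
    {h : G → ℝ} (hh : ∀ z, menv (1 / γ) (fconj g) z = (h z : EReal)) (z : G) {ε : ℝ}
    (hε : 0 < ε) :
    ∃ (y : G) (r : ℝ), fconj (fconj g) y ≤ (r : EReal) ∧
      h z - ε = ⟪z, y⟫ - r - ‖y‖ ^ 2 / (2 * γ) := by
  obtain ⟨l, d, hle, heq⟩ := (convexOn_menv_fconj hγ hh).exists_affine_le_of_lt (𝕜 := ℝ)
    (mem_univ z) (sub_lt_self (h z) hε) isClosed_univ
    ((continuous_menv_fconj hm hγ hh).lowerSemicontinuous.lowerSemicontinuousOn _)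
  obtain ⟨y, rfl⟩ := (InnerProductSpace.toDual ℝ G).surjective l
  have hle' : ∀ w, ⟪w, y⟫ + d ≤ h w := fun w => by
    have := hle ⟨w, mem_univ w⟩
    simpa [real_inner_comm] using this
  have heq' : ⟪z, y⟫ + d = h z - ε := by simpa [real_inner_comm] using heq
  refine ⟨y, -d - ‖y‖ ^ 2 / (2 * γ), ?_, by linarith⟩
  rw [fconj_le_coe_iff_s7]
  intro v
  by_contra! hlt
  obtain ⟨s, hs, hst⟩ := EReal.lt_iff_exists_real_btwn.1 hlt
  have h1 := menv_le_coe _ γ hs.le (v + γ⁻¹ • y)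
  rw [hh, EReal.coe_le_coe_iff, add_sub_cancel_left, norm_smul, mul_pow, Real.norm_eq_abs,
    sq_abs] at h1
  have h2 := hle' (v + γ⁻¹ • y)
  rw [inner_add_left, inner_smul_left, real_inner_self_eq_norm_sq] at h2
  simp only [conj_trivial] at h2
  have h3 := EReal.coe_lt_coe_iff.1 hst
  have e1 : γ / 2 * (γ⁻¹ ^ 2 * ‖y‖ ^ 2) = ‖y‖ ^ 2 / (2 * γ) := by field_simp
  have e2 : γ⁻¹ * ‖y‖ ^ 2 = ‖y‖ ^ 2 / (2 * γ) + ‖y‖ ^ 2 / (2 * γ) := by field_simp; ring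
  linarith

lemma ConvexE.convex_combination_le {f : G → EReal} {α : ℝ}
    (hconv : ConvexE (fun y : G => f y - ((α * qk y : ℝ) : EReal)))
    {a b : ℝ} (ha : 0 < a) (hb : 0 < b) (hab : a + b = 1) {y₁ y₂ : G} {r₁ r₂ : ℝ}
    (h₁ : f y₁ ≤ (r₁ : EReal)) (h₂ : f y₂ ≤ (r₂ : EReal)) :
    f (a • y₁ + b • y₂) ≤ ((a * (r₁ - α * qk y₁) + b * (r₂ - α * qk y₂)
      + α * qk (a • y₁ + b • y₂) : ℝ) : EReal) := by
  have key := hconv y₁ y₂ a b ha hb hab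
  have l₁ : f y₁ - ((α * qk y₁ : ℝ) : EReal) ≤ ((r₁ - α * qk y₁ : ℝ) : EReal) := by
    rw [EReal.coe_sub]; exact EReal.sub_le_sub h₁ le_rfl
  have l₂ : f y₂ - ((α * qk y₂ : ℝ) : EReal) ≤ ((r₂ - α * qk y₂ : ℝ) : EReal) := by
    rw [EReal.coe_sub]; exact EReal.sub_le_sub h₂ le_rfl
  have k := key.trans (add_le_add
    (mul_le_mul_of_nonneg_left l₁ (EReal.coe_nonneg.2 ha.le))
    (mul_le_mul_of_nonneg_left l₂ (EReal.coe_nonneg.2 hb.le)))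
  rw [EReal.sub_le_iff_le_add (.inl (EReal.coe_ne_bot _)) (.inl (EReal.coe_ne_top _))] at k
  exact_mod_cast k

/-- Strong convexity of `g** + Q / γ` with modulus `α + 1 / γ` makes the Moreau envelope of `g*`
smooth, in the sense that it is dominated in curvature by the dual quadratic. -/
lemma convexOn_quadratic_sub_menv_fconj [CompleteSpace G] {g : G → EReal}
    (hm : HasAffMinorant g) {γ α ρ : ℝ} (hγ : 0 < γ) (hρ : 0 < ρ) (hαρ : ρ = α + 1 / γ)
    (hconv : ConvexE (fun y : G => fconj (fconj g) y - ((α * qk y : ℝ) : EReal)))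
    {h : G → ℝ} (hh : ∀ z, menv (1 / γ) (fconj g) z = (h z : EReal)) :
    ConvexOn ℝ univ (fun z => ‖z‖ ^ 2 / (2 * ρ) - h z) := by
  refine convexOn_iff_forall_pos.2 ⟨convex_univ, fun z _ w _ a b ha hb hab =>
    le_of_forall_pos_le_add fun ε hε => ?_⟩
  obtain ⟨y₁, r₁, h₁, l₁⟩ := exists_menv_fconj_le hm hγ hh z hε
  obtain ⟨y₂, r₂, h₂, l₂⟩ := exists_menv_fconj_le hm hγ hh w hε
  have key := coe_le_menv_fconj g hγ (hconv.convex_combination_le ha hb hab h₁ h₂)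
    (a • z + b • w)
  rw [hh, EReal.coe_le_coe_iff] at key
  have sq : ∀ z y : G, ‖z - ρ • y‖ ^ 2 / (2 * ρ)
      = ‖z‖ ^ 2 / (2 * ρ) - ⟪z, y⟫ + (α * qk y + ‖y‖ ^ 2 / (2 * γ)) := fun z y => by
    have : α * qk y + ‖y‖ ^ 2 / (2 * γ) = ρ * ‖y‖ ^ 2 / 2 := by
      rw [hαρ, qk]; field_simp
    rw [this, norm_sub_sq_real, norm_smul, inner_smul_right, mul_pow, Real.norm_eq_abs, sq_abs]
    field_simp
  have e : a • z + b • w - ρ • (a • y₁ + b • y₂) = a • (z - ρ • y₁) + b • (w - ρ • y₂) := by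
    simp only [smul_sub, smul_add, smul_comm ρ]; abel
  have s := sq (a • z + b • w) (a • y₁ + b • y₂)
  rw [e, norm_sq_convex_combination _ _ hab] at s
  have hq : 0 ≤ a * b * ‖z - ρ • y₁ - (w - ρ • y₂)‖ ^ 2 / (2 * ρ) := by positivity
  have s' : (a * ‖z - ρ • y₁‖ ^ 2 + b * ‖w - ρ • y₂‖ ^ 2
      - a * b * ‖z - ρ • y₁ - (w - ρ • y₂)‖ ^ 2) / (2 * ρ)
      = a * (‖z - ρ • y₁‖ ^ 2 / (2 * ρ)) + b * (‖w - ρ • y₂‖ ^ 2 / (2 * ρ))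
        - a * b * ‖z - ρ • y₁ - (w - ρ • y₂)‖ ^ 2 / (2 * ρ) := by ring
  rw [s', sq, sq] at s
  have n₁ : a * (h z - ε) = a * (⟪z, y₁⟫ - r₁ - ‖y₁‖ ^ 2 / (2 * γ)) := by rw [l₁]
  have n₂ : b * (h w - ε) = b * (⟪w, y₂⟫ - r₂ - ‖y₂‖ ^ 2 / (2 * γ)) := by rw [l₂]
  have n₃ : a * ε + b * ε = ε := by rw [← add_mul, hab, one_mul]
  simp only [smul_eq_mul]
  linarith

lemma convexOn_opNorm_sq_sub (L : H →L[ℝ] G) :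
    ConvexOn ℝ univ (fun x => ‖L‖ ^ 2 * ‖x‖ ^ 2 - ‖L x‖ ^ 2) := by
  refine ⟨convex_univ, fun x _ y _ a b ha hb hab => ?_⟩
  have h : ‖L x - L y‖ ^ 2 ≤ ‖L‖ ^ 2 * ‖x - y‖ ^ 2 := by
    rw [← map_sub, ← mul_pow]
    exact pow_le_pow_left₀ (norm_nonneg _) (L.le_opNorm _) 2
  have h' := mul_le_mul_of_nonneg_left h (mul_nonneg ha hb)
  simp only [map_add, map_smul, norm_sq_convex_combination _ _ hab, smul_eq_mul]
  linarith

lemma isGamma0_iSup {ι : Type*} [Nonempty ι] {φ : ι → H → ℝ} (hcont : ∀ i, Continuous (φ i))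
    (hconv : ∀ i, ConvexOn ℝ univ (φ i)) {x₀ : H} {C : ℝ} (hC : ∀ i, φ i x₀ ≤ C) :
    IsGamma0 (fun x => ⨆ i, (φ i x : EReal)) := by
  refine ⟨⟨⟨x₀, ?_⟩, fun x => ?_⟩, ?_, fun x y a b ha hb hab => iSup_le fun i => ?_⟩
  · exact ((iSup_le fun i => EReal.coe_le_coe_iff.2 (hC i)).trans_lt (EReal.coe_lt_top C)).ne
  · obtain ⟨i⟩ := ‹Nonempty ι›
    exact ((EReal.bot_lt_coe _).trans_le (le_iSup (fun i => (φ i x : EReal)) i)).ne'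
  · exact lowerSemicontinuous_iSup fun i =>
      (continuous_coe_real_ereal.comp (hcont i)).lowerSemicontinuous
  · have h := (hconv i).2 (mem_univ x) (mem_univ y) ha.le hb.le hab
    simp only [smul_eq_mul] at h
    refine (EReal.coe_le_coe_iff.2 h).trans ?_
    rw [EReal.coe_add, EReal.coe_mul, EReal.coe_mul]
    exact add_le_add
      (mul_le_mul_of_nonneg_left (le_iSup (fun i => (φ i x : EReal)) i)
        (EReal.coe_nonneg.2 ha.le))
      (mul_le_mul_of_nonneg_left (le_iSup (fun i => (φ i y : EReal)) i)
        (EReal.coe_nonneg.2 hb.le))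

lemma iSup_coe_sub_coe {ι : Type*} (u : ι → ℝ) (r : ℝ) :
    (⨆ i, (u i : EReal)) - (r : EReal) = ⨆ i, ((u i - r : ℝ) : EReal) := by
  apply le_antisymm
  · refine EReal.sub_le_of_le_add (iSup_le fun i => ?_)
    have h := add_le_add_left (le_iSup (fun i => ((u i - r : ℝ) : EReal)) i) (r : EReal)
    refine le_trans (le_of_eq ?_) h
    rw [← EReal.coe_add, sub_add_cancel]
  · refine iSup_le fun i => ?_
    rw [EReal.coe_sub]
    exact EReal.sub_le_sub (le_iSup (fun i => (u i : EReal)) i) le_rfl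

end Helpers

/-- If `g** − α·Q_G` is convex with `α ≥ −1/γ`, and
`β = (α + 1/γ)/‖L‖² − 1/γ`, then `L ⊙_γ g − β·Q_H ∈ Γ₀(H)`. -/
theorem proxComp_sub_quadratic_isGamma0
    {H G : Type*} [NormedAddCommGroup H] [InnerProductSpace ℝ H] [CompleteSpace H]
    [NormedAddCommGroup G] [InnerProductSpace ℝ G] [CompleteSpace G]
    (L : H →L[ℝ] G) (hL : L ≠ 0) (g : G → EReal) (hg : ProperE g) (hm : HasAffMinorant g)
    (γ : ℝ) (hγ : 0 < γ) (α : ℝ) (hα : -(1 / γ) ≤ α)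
    (hconv : ConvexE (fun y : G => fconj (fconj g) y - ((α * qk y : ℝ) : EReal)))
    (β : ℝ) (hβ : β = (α + 1 / γ) / ‖L‖ ^ 2 - 1 / γ) :
    IsGamma0 (fun x : H => proxComp L γ g x - ((β * qk x : ℝ) : EReal)) := by
  obtain ⟨h, hh⟩ := exists_real_menv_fconj hg hm hγ
  have hcont := continuous_menv_fconj hm hγ hh
  set ψ : H → H → ℝ := fun z x => ⟪z, x⟫ - h (L z) - 1 / γ * qk x - β * qk x with hψ
  have hF : (fun x : H => proxComp L γ g x - ((β * qk x : ℝ) : EReal))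
      = fun x => ⨆ z, (ψ z x : EReal) := by
    funext x
    simp only [proxComp, hh]
    simp only [fconj, hψ, ← EReal.coe_sub]
    rw [iSup_coe_sub_coe, iSup_coe_sub_coe]
  rw [hF]
  obtain ⟨y, hy⟩ := hg.1
  have hbound : ∀ z, ψ z (L.adjoint y) ≤ (g y).toReal + ‖y‖ ^ 2 / (2 * γ)
      - 1 / γ * qk (L.adjoint y) - β * qk (L.adjoint y) := fun z => by
    have := coe_le_menv_fconj g hγ (fconj_fconj_le_coe g (EReal.le_coe_toReal hy)) (L z)
    rw [hh, EReal.coe_le_coe_iff] at this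
    simp only [hψ, ContinuousLinearMap.adjoint_inner_right]
    linarith
  have hL' : 0 < ‖L‖ := norm_pos_iff.2 hL
  obtain hρ | hρ := (show 0 ≤ α + 1 / γ by linarith).eq_or_lt
  · have hβ' : β = -(1 / γ) := by rw [hβ, ← hρ]; simp
    have hψ' : ψ = fun z x => ⟪z, x⟫ - h (L z) := by
      funext z x
      simp only [hψ, hβ']
      ring
    refine isGamma0_iSup (fun z => ?_) (fun z => ?_) hbound
    · rw [hψ']; fun_prop
    · rw [hψ']
      refine (((innerSL ℝ z).toLinearMap.convexOn convex_univ).add_const (-h (L z))).congr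
        fun x _ => ?_
      simp [sub_eq_add_neg]
  · set ρ := α + 1 / γ with hρdef
    set c := ‖L‖ ^ 2 / ρ with hc
    have hc0 : 0 < c := by positivity
    have hk : ConvexOn ℝ univ (fun x => c / 2 * ‖x‖ ^ 2 - h (L x)) := by
      have h1 := (convexOn_opNorm_sq_sub L).smul (c := 1 / (2 * ρ)) (by positivity)
      have h2 := (convexOn_quadratic_sub_menv_fconj hm hγ hρ hρdef hconv hh).comp_linearMap
        L.toLinearMap
      refine (h1.add h2).congr fun x _ => ?_
      simp [hc]
      field_simp
      ring
    have hβ' : 1 / γ + β = c⁻¹ := by rw [hβ, hc, inv_div]; ring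
    have hrep : (fun x => ⨆ z, (ψ z x : EReal))
        = fun x => ⨆ z, (ψ (c⁻¹ • x - z) x : EReal) := by
      funext x
      exact ((Equiv.subLeft (c⁻¹ • x)).iSup_comp (g := fun z => (ψ z x : EReal))).symm
    have hψ' : ∀ z x, ψ (c⁻¹ • x - z) x
        = (c / 2 * ‖c⁻¹ • x - z‖ ^ 2 - h (L (c⁻¹ • x - z))) - c / 2 * ‖z‖ ^ 2 := by
      intro z x
      have e : ψ (c⁻¹ • x - z) x = ⟪c⁻¹ • x - z, x⟫ - h (L (c⁻¹ • x - z)) - c⁻¹ * qk x := by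
        rw [← hβ']; simp only [hψ]; ring
      rw [e, norm_sub_sq_real, norm_smul, inner_sub_left, inner_smul_left, inner_smul_left,
        real_inner_self_eq_norm_sq, real_inner_comm, mul_pow, Real.norm_eq_abs, sq_abs, qk]
      simp only [conj_trivial]
      field_simp
      ring
    rw [hrep]
    refine isGamma0_iSup (fun z => ?_) (fun z => ?_) (fun z => hbound _)
    · simp only [hψ', c]; fun_prop
    · simp only [hψ']
      have h3 := (hk.translate_right (-z)).comp_linearMap (c⁻¹ • LinearMap.id : H →ₗ[ℝ] H)
      refine (h3.add_const (-(c / 2 * ‖z‖ ^ 2))).congr fun x _ => ?_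
      simp [sub_eq_neg_add, add_comm]
end

section
/- Let L ∈ B(H,G) satisfy 0 < ‖L‖ ≤ 1, let g : G → (−∞,+∞] be proper with a continuous affine minorant, and let γ > 0. Then: (i) L ⊙_γ g ∈ Γ₀(H) and L ⊚_γ g ∈ Γ₀(H); (ii) (L ⊚_γ g)* = L ⊙_{1/γ} g*; (iii) L ⊙_γ g = (L ⊚_{1/γ} g*)*. -/
open scoped RealInnerProductSpace
open Filter Set

/-- A pointwise supremum of a nonempty family of continuous affine functions. -/
def IsAffineSup {H : Type*} [NormedAddCommGroup H] [InnerProductSpace ℝ H]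
    (f : H → EReal) : Prop :=
  ∃ S : Set (H × ℝ), S.Nonempty ∧ ∀ x, f x = ⨆ p ∈ S, ((⟪x, p.1⟫ + p.2 : ℝ) : EReal)

section Conjugate

variable {H : Type*} [NormedAddCommGroup H] [InnerProductSpace ℝ H] {f : H → EReal}

theorem IsAffineSup.hasAffMinorant (hf : IsAffineSup f) : HasAffMinorant f := by
  obtain ⟨S, ⟨p, hp⟩, h⟩ := hf
  refine ⟨p.1, p.2, fun x => ?_⟩
  rw [h]
  exact le_iSup₂_of_le p hp le_rfl

theorem HasAffMinorant.ne_bot (hf : HasAffMinorant f) (x : H) : f x ≠ ⊥ := by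
  obtain ⟨u, c, h⟩ := hf
  exact ((EReal.bot_lt_coe _).trans_le (h x)).ne'

theorem IsAffineSup.isGamma0 (hf : IsAffineSup f) (hf' : ∃ x, f x ≠ ⊤) : IsGamma0 f := by
  refine ⟨⟨hf', hf.hasAffMinorant.ne_bot⟩, ?_, ?_⟩
  · obtain ⟨S, -, h⟩ := hf
    rw [funext h]
    refine lowerSemicontinuous_biSup fun p _ => Continuous.lowerSemicontinuous ?_
    exact continuous_coe_real_ereal.comp (by fun_prop)
  · obtain ⟨S, -, h⟩ := hf
    intro x y a b ha hb hab
    have hle : ∀ z, ∀ p ∈ S, ((⟪z, p.1⟫ + p.2 : ℝ) : EReal) ≤ f z := fun z p hp => by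
      rw [h]
      exact le_iSup₂_of_le p hp le_rfl
    rw [h (a • x + b • y)]
    refine iSup₂_le fun p hp => ?_
    have hsplit : ⟪a • x + b • y, p.1⟫ + p.2
        = a * (⟪x, p.1⟫ + p.2) + b * (⟪y, p.1⟫ + p.2) := by
      rw [inner_add_left, real_inner_smul_left, real_inner_smul_left]
      linear_combination (-p.2) * hab
    rw [hsplit, EReal.coe_add, EReal.coe_mul, EReal.coe_mul]
    exact add_le_add
      (mul_le_mul_of_nonneg_left (hle x p hp) (EReal.coe_nonneg.2 ha.le))
      (mul_le_mul_of_nonneg_left (hle y p hp) (EReal.coe_nonneg.2 hb.le))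

theorem fconj_le_of_affine_le {u : H} {c : ℝ}
    (h : ∀ x, ((⟪x, u⟫ + c : ℝ) : EReal) ≤ f x) : fconj f u ≤ ((-c : ℝ) : EReal) := by
  refine iSup_le fun x => ?_
  refine (EReal.sub_le_sub le_rfl (h x)).trans ?_
  rw [← EReal.coe_sub, EReal.coe_le_coe_iff]
  linarith

theorem HasAffMinorant.exists_fconj_ne_top (hf : HasAffMinorant f) : ∃ u, fconj f u ≠ ⊤ := by
  obtain ⟨u, c, h⟩ := hf
  exact ⟨u, ((fconj_le_of_affine_le h).trans_lt (EReal.coe_lt_top _)).ne⟩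

theorem ProperE.isAffineSup_fconj (hf : ProperE f) : IsAffineSup (fconj f) := by
  obtain ⟨⟨x₀, h₀⟩, hbot⟩ := hf
  refine ⟨{p | f p.1 ≤ ((-p.2 : ℝ) : EReal)}, ⟨(x₀, -(f x₀).toReal), ?_⟩, fun u => ?_⟩
  · simp [EReal.coe_toReal h₀ (hbot x₀)]
  · refine le_antisymm (iSup_le fun x => ?_) (iSup₂_le fun p hp => ?_)
    · by_cases hx : f x = ⊤
      · simp [hx]
      · lift f x to ℝ using ⟨hx, hbot x⟩ with t ht
        refine le_iSup₂_of_le (x, -t) (by simp [← ht]) ?_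
        rw [← EReal.coe_sub, EReal.coe_le_coe_iff, real_inner_comm, sub_eq_add_neg]
    · refine le_trans ?_ (le_iSup _ p.1)
      refine le_trans ?_ (EReal.sub_le_sub le_rfl hp)
      rw [← EReal.coe_sub, EReal.coe_le_coe_iff, real_inner_comm, sub_neg_eq_add]

theorem fconj_antitone {f₁ f₂ : H → EReal} (h : f₁ ≤ f₂) : fconj f₂ ≤ fconj f₁ :=
  fun _ => iSup_mono fun x => EReal.sub_le_sub le_rfl (h x)

theorem coe_sub_le_comm (a : ℝ) {b c : EReal} (h : (a : EReal) - b ≤ c) : (a : EReal) - c ≤ b := by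
  induction b <;> induction c <;> simp_all [← EReal.coe_sub]
  linarith

theorem fconj_fconj_le (f : H → EReal) : fconj (fconj f) ≤ f := by
  intro x
  refine iSup_le fun u => coe_sub_le_comm _ ?_
  rw [real_inner_comm]
  exact le_iSup (fun y => ((⟪y, u⟫ : ℝ) : EReal) - f y) x

theorem fconj_fconj_fconj (f : H → EReal) : fconj (fconj (fconj f)) = fconj f :=
  le_antisymm (fconj_fconj_le _) (fconj_antitone (fconj_fconj_le f))

theorem IsAffineSup.fconj_fconj (hf : IsAffineSup f) : fconj (fconj f) = f := by
  refine le_antisymm (fconj_fconj_le f) fun x => ?_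
  obtain ⟨S, -, h⟩ := hf
  rw [h x]
  refine iSup₂_le fun p hp => ?_
  have hle : fconj f p.1 ≤ ((-p.2 : ℝ) : EReal) := fconj_le_of_affine_le fun y => by
    rw [h]
    exact le_iSup₂_of_le p hp le_rfl
  refine le_trans ?_ (le_iSup _ p.1)
  refine le_trans ?_ (EReal.sub_le_sub le_rfl hle)
  rw [← EReal.coe_sub, EReal.coe_le_coe_iff, real_inner_comm, sub_neg_eq_add]

theorem ProperE.fconj (hf : ProperE f) (hm : HasAffMinorant f) : ProperE (fconj f) :=
  ⟨hm.exists_fconj_ne_top, hf.isAffineSup_fconj.hasAffMinorant.ne_bot⟩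

end Conjugate

section ProximalComposition

theorem menv_one_div {G : Type*} [NormedAddCommGroup G] (γ : ℝ) (h : G → EReal) (z : G) :
    menv (1 / γ) h z = ⨅ y, h y + ((γ / 2 * ‖z - y‖ ^ 2 : ℝ) : EReal) := by
  refine iInf_congr fun y => ?_
  congr 2
  by_cases hγ : γ = 0
  · simp [hγ]
  · field_simp

theorem inner_add_half_sq {H : Type*} [NormedAddCommGroup H] [InnerProductSpace ℝ H] {γ : ℝ}
    (hγ : 0 < γ) (x p : H) :
    ⟪x, p⟫ + γ / 2 * ‖p‖ ^ 2 + 1 / γ * qk x = γ / 2 * ‖γ⁻¹ • x + p‖ ^ 2 := by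
  rw [norm_add_sq_real, norm_smul, mul_pow, real_inner_smul_left, Real.norm_eq_abs, sq_abs, qk]
  field_simp
  ring

theorem mul_inner_inv_smul_add {H : Type*} [NormedAddCommGroup H] [InnerProductSpace ℝ H] {γ : ℝ}
    (hγ : 0 < γ) (x p z : H) :
    γ * ⟪γ⁻¹ • x + p, z⟫ = ⟪z, x⟫ + γ * ⟪z, p⟫ := by
  rw [inner_add_left, real_inner_smul_left, real_inner_comm, real_inner_comm z p]
  field_simp

variable {H G : Type*} [NormedAddCommGroup H] [InnerProductSpace ℝ H] [CompleteSpace H]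
  [NormedAddCommGroup G] [InnerProductSpace ℝ G] [CompleteSpace G]
  {L : H →L[ℝ] G} {g : G → EReal} {γ : ℝ}

/-- The slope of the affine minorant of `L ⊙_γ g` generated by the pair `(w, y)`. -/
noncomputable def proxSlope (L : H →L[ℝ] G) (w : H) (y : G) : H :=
  w - L.adjoint (L w) + L.adjoint y

theorem inner_proxSlope (z w : H) (y : G) :
    ⟪z, proxSlope L w y⟫ = ⟪z, w⟫ - ⟪L z, L w⟫ + ⟪L z, y⟫ := by
  simp [proxSlope, inner_add_right, inner_sub_right, ContinuousLinearMap.adjoint_inner_right]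

/-- The constant of the affine minorant of `L ⊙_γ g` generated by `(w, y)` and a bound `t` on
`g* y`. -/
noncomputable def proxConst (L : H →L[ℝ] G) (γ : ℝ) (w : H) (y : G) (t : ℝ) : ℝ :=
  γ / 2 * ‖proxSlope L w y‖ ^ 2 - γ / 2 * (‖w‖ ^ 2 - ‖L w‖ ^ 2) - γ / 2 * ‖y‖ ^ 2 - t

theorem affine_le_inner_sub (hL1 : ‖L‖ ≤ 1) (hγ : 0 < γ) (x w z : H) (y : G) (t : ℝ)
    (hz : z = γ⁻¹ • x + proxSlope L w y) :
    ⟪x, proxSlope L w y⟫ + proxConst L γ w y t + 1 / γ * qk x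
      ≤ ⟪z, x⟫ - (t + γ / 2 * ‖L z - y‖ ^ 2) := by
  have hLw : ‖L (z - w)‖ ^ 2 ≤ ‖z - w‖ ^ 2 := by
    have := L.le_of_opNorm_le hL1 (z - w)
    gcongr
    simpa using this
  have hsq := inner_add_half_sq hγ x (proxSlope L w y)
  have hin := mul_inner_inv_smul_add hγ x (proxSlope L w y) z
  rw [← hz] at hsq hin
  rw [real_inner_self_eq_norm_sq, inner_proxSlope] at hin
  rw [map_sub, norm_sub_sq_real, norm_sub_sq_real] at hLw
  rw [norm_sub_sq_real, proxConst]
  linear_combination hsq + hin + γ / 2 * hLw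

theorem inner_sub_le_affine (hγ : 0 < γ) (x z : H) (y : G) (t : ℝ) :
    ⟪z, x⟫ - (t + γ / 2 * ‖L z - y‖ ^ 2)
      ≤ ⟪x, proxSlope L z y⟫ + proxConst L γ z y t + 1 / γ * qk x := by
  have hsq := inner_add_half_sq hγ x (proxSlope L z y)
  have hin := mul_inner_inv_smul_add hγ x (proxSlope L z y) z
  have hnn := sq_nonneg ‖γ⁻¹ • x + proxSlope L z y - z‖
  rw [norm_sub_sq_real] at hnn
  rw [inner_proxSlope, real_inner_self_eq_norm_sq, real_inner_self_eq_norm_sq] at hin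
  rw [norm_sub_sq_real, proxConst]
  linear_combination γ / 2 * hnn - hsq - hin

theorem isAffineSup_proxComp (hL1 : ‖L‖ ≤ 1) (hg : ProperE g) (hm : HasAffMinorant g)
    (hγ : 0 < γ) : IsAffineSup (proxComp L γ g) := by
  obtain ⟨⟨y₀, h₀⟩, hbot⟩ := hg.fconj hm
  have hne : {p : H × ℝ | ∃ w y t, fconj g y ≤ ((t : ℝ) : EReal) ∧
      p = (proxSlope L w y, proxConst L γ w y t)}.Nonempty :=
    ⟨_, 0, y₀, (fconj g y₀).toReal, (EReal.coe_toReal h₀ (hbot y₀)).ge, rfl⟩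
  refine ⟨_, hne, fun x => ?_⟩
  refine le_antisymm ?_ (iSup₂_le ?_)
  · refine EReal.sub_le_of_le_add (iSup_le fun z => coe_sub_le_comm _ ?_)
    simp only [menv_one_div]
    refine le_iInf fun y => ?_
    by_cases hy : fconj g y = ⊤
    · rw [hy, EReal.top_add_coe]
      exact le_top
    · lift fconj g y to ℝ using ⟨hy, hbot y⟩ with t ht
      rw [← EReal.coe_add]
      apply coe_sub_le_comm
      rw [← EReal.coe_sub]
      refine (EReal.coe_le_coe_iff.2 (inner_sub_le_affine hγ x z y t)).trans ?_
      rw [EReal.coe_add]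
      gcongr
      exact le_iSup₂_of_le (f := fun (p : H × ℝ) _ => ((⟪x, p.1⟫ + p.2 : ℝ) : EReal))
        (proxSlope L z y, proxConst L γ z y t) ⟨z, y, t, ht.ge, rfl⟩ le_rfl
  · rintro _ ⟨w, y, t, ht, rfl⟩
    refine EReal.le_sub_iff_add_le (.inl (EReal.coe_ne_bot _)) (.inl (EReal.coe_ne_top _)) |>.2 ?_
    rw [← EReal.coe_add]
    refine (EReal.coe_le_coe_iff.2 (affine_le_inner_sub hL1 hγ x w _ y t rfl)).trans ?_
    refine le_trans ?_ (le_iSup _ (γ⁻¹ • x + proxSlope L w y))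
    rw [EReal.coe_sub]
    refine EReal.sub_le_sub le_rfl ?_
    beta_reduce
    rw [menv_one_div, EReal.coe_add]
    exact (iInf_le _ y).trans (by gcongr)

theorem exists_proxComp_ne_top (hg : ProperE g) (hγ : 0 < γ) : ∃ x, proxComp L γ g x ≠ ⊤ := by
  obtain ⟨⟨y₀, h₀⟩, hbot⟩ := hg
  lift g y₀ to ℝ using ⟨h₀, hbot y₀⟩ with r hr
  have hmin : HasAffMinorant fun z => menv (1 / γ) (fconj g) (L z) := by
    refine ⟨L.adjoint y₀, -(‖y₀‖ ^ 2 / (2 * γ)) - r, fun z => ?_⟩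
    simp only [menv_one_div]
    refine le_iInf fun y => ?_
    have hy : ((⟪y₀, y⟫ - r : ℝ) : EReal) ≤ fconj g y := by
      rw [EReal.coe_sub, hr]
      exact le_iSup (fun x => ((⟪x, y⟫ : ℝ) : EReal) - g x) y₀
    refine le_trans ?_ (add_le_add_left hy _)
    rw [← EReal.coe_add, EReal.coe_le_coe_iff, ContinuousLinearMap.adjoint_inner_right]
    have hsq := sq_nonneg ‖γ • (L z - y) - y₀‖
    rw [norm_sub_sq_real, norm_smul, mul_pow, real_inner_smul_left, Real.norm_eq_abs, sq_abs,
      inner_sub_left, real_inner_comm y₀ y] at hsq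
    have hdiv := div_nonneg hsq (by positivity : 0 ≤ 2 * γ)
    have hexp : (γ ^ 2 * ‖L z - y‖ ^ 2 - 2 * (γ * (⟪L z, y₀⟫ - ⟪y₀, y⟫)) + ‖y₀‖ ^ 2) / (2 * γ)
        = γ / 2 * ‖L z - y‖ ^ 2 - (⟪L z, y₀⟫ - ⟪y₀, y⟫) + ‖y₀‖ ^ 2 / (2 * γ) := by
      field_simp
    linarith
  obtain ⟨u, hu⟩ := hmin.exists_fconj_ne_top
  refine ⟨u, fun h => hu ?_⟩
  rw [proxComp] at h
  by_contra hu'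
  exact (EReal.sub_lt_iff (.inl (EReal.coe_ne_bot _)) (.inl (EReal.coe_ne_top _)) |>.2
    (by rw [EReal.top_add_coe]; exact lt_top_iff_ne_top.2 hu')).ne h

end ProximalComposition

/-- For `0 < ‖L‖ ≤ 1`: `L ⊙_γ g, L ⊚_γ g ∈ Γ₀(H)`, `(L ⊚_γ g)* = L ⊙_{1/γ} g*`,
and `L ⊙_γ g = (L ⊚_{1/γ} g*)*`. -/
theorem proxComp_proxCocomp_gamma0_and_conjugacies
    {H G : Type*} [NormedAddCommGroup H] [InnerProductSpace ℝ H] [CompleteSpace H]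
    [NormedAddCommGroup G] [InnerProductSpace ℝ G] [CompleteSpace G]
    (L : H →L[ℝ] G) (hL0 : 0 < ‖L‖) (hL1 : ‖L‖ ≤ 1)
    (g : G → EReal) (hg : ProperE g) (hm : HasAffMinorant g)
    (γ : ℝ) (hγ : 0 < γ) :
    IsGamma0 (proxComp L γ g) ∧ IsGamma0 (proxCocomp L γ g) ∧
    fconj (proxCocomp L γ g) = proxComp L (1 / γ) (fconj g) ∧
    proxComp L γ g = fconj (proxCocomp L (1 / γ) (fconj g)) := by
  have hg' := hg.fconj hm
  have hm' := hg.isAffineSup_fconj.hasAffMinorant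
  have hγ' : 0 < 1 / γ := by positivity
  have hcomp := isAffineSup_proxComp hL1 hg hm hγ
  have hcomp' := isAffineSup_proxComp hL1 hg' hm' hγ'
  have htop' := exists_proxComp_ne_top (L := L) hg' hγ'
  have hprop' : ProperE (proxComp L (1 / γ) (fconj g)) := ⟨htop', hcomp'.hasAffMinorant.ne_bot⟩
  refine ⟨hcomp.isGamma0 (exists_proxComp_ne_top hg hγ),
    hprop'.isAffineSup_fconj.isGamma0 hcomp'.hasAffMinorant.exists_fconj_ne_top,
    hcomp'.fconj_fconj, ?_⟩
  have hbiconj : proxComp L γ (fconj (fconj g)) = proxComp L γ g := by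
    unfold proxComp
    rw [fconj_fconj_fconj]
  rw [proxCocomp, one_div_one_div, hbiconj, hcomp.fconj_fconj]
end
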